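/- (Bulow–Klemperer) Let F be a regular cdf on [0,∞) with density f and finite expectation, with virtual value ψ. Let X₁, …, X_{n+1} be i.i.d. ∼ F. Then the expected revenue of the Vickrey auction with n+1 bidders is at least the expected revenue of the Myerson auction with n bidders: E[ second-highest of X₁, …, X_{n+1} ] ≥ E[ max(0, max_{1 ≤ i ≤ n} ψ(Xᵢ)) ]. -/

import Mathlib

open MeasureTheory Set

/-- The probability measure of a bidder whose value has density `f` on `[0,∞)`. -/
noncomputable def valueMeasure (f : ℝ → ℝ) : Measure ℝ :=
  (volume.restrict (Ici 0)).withDensity fun x => ENNReal.ofReal (f x)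

/-- The second-highest of `n ≥ 2` values. -/
noncomputable def secondHighest {n : ℕ} (hn : 2 ≤ n) (x : Fin n → ℝ) : ℝ :=
  Finset.univ.sup' ⟨⟨0, by omega⟩, Finset.mem_univ _⟩ fun i =>
    min (x i)
      ((Finset.univ.erase i).sup'
        (by
          rw [← Finset.card_pos, Finset.card_erase_of_mem (Finset.mem_univ i),
            Finset.card_univ, Fintype.card_fin]
          omega)
        x)

theorem bk_integrable_iff {f : ℝ → ℝ} (hf_cont : Continuous f) (g : ℝ → ℝ)
    (hf_pos : ∀ x, 0 ≤ x → 0 < f x) :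
    Integrable g (valueMeasure f) ↔ IntegrableOn (fun x => f x * g x) (Ici 0) := by
  have h := integrable_withDensity_iff_integrable_smul (μ := volume.restrict (Ici (0:ℝ)))
    (f := fun x => (f x).toNNReal) (by fun_prop) (g := g)
  refine Iff.trans h ?_
  refine integrable_congr ?_
  filter_upwards [ae_restrict_mem measurableSet_Ici] with x hx
  simp [NNReal.smul_def, (hf_pos x hx).le]

theorem bk_integral {f : ℝ → ℝ} (hf_cont : Continuous f) (g : ℝ → ℝ)
    (hf_pos : ∀ x, 0 ≤ x → 0 < f x) :
    ∫ x, g x ∂(valueMeasure f) = ∫ x in Ici 0, f x * g x := by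
  have h := integral_withDensity_eq_integral_smul (μ := volume.restrict (Ici (0:ℝ)))
    (f := fun x => (f x).toNNReal) (by fun_prop) (g := g)
  refine Eq.trans h ?_
  refine integral_congr_ae ?_
  filter_upwards [ae_restrict_mem measurableSet_Ici] with x hx
  simp [NNReal.smul_def, (hf_pos x hx).le]

theorem bk_ae_nonneg (f : ℝ → ℝ) : ∀ᵐ x ∂(valueMeasure f), 0 ≤ x :=
  (withDensity_absolutelyContinuous _ _).ae_le (ae_restrict_mem measurableSet_Ici)

theorem bk_null (f : ℝ → ℝ) (c : ℝ) : valueMeasure f {c} = 0 :=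
  (withDensity_absolutelyContinuous _ _) (by simp)

theorem bk_tail {f F : ℝ → ℝ} (hf_cont : Continuous f) (hf_pos : ∀ x, 0 ≤ x → 0 < f x)
    (hF : ∀ x, F x = ∫ t in (0:ℝ)..x, f t) (hprob : IsProbabilityMeasure (valueMeasure f))
    (x : ℝ) (hx : 0 ≤ x) : (valueMeasure f).real (Ioi x) = 1 - F x := by
  have h1 : (valueMeasure f).real (Iic x) = F x := by
    rw [← integral_indicator_one measurableSet_Iic, bk_integral hf_cont _ hf_pos, hF,
      intervalIntegral.integral_of_le hx, ← integral_Icc_eq_integral_Ioc,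
      ← Ici_inter_Iic, ← setIntegral_indicator measurableSet_Iic]
    congr 1; ext y
    by_cases hy : y ∈ Iic x <;> simp [hy]
  rw [← h1, ← compl_Iic, probReal_compl_eq_one_sub measurableSet_Iic]

theorem bk_one_dim {F f ψ : ℝ → ℝ}
    (hf_cont : Continuous f) (hf_pos : ∀ x, 0 ≤ x → 0 < f x)
    (hF : ∀ x, F x = ∫ t in (0:ℝ)..x, f t)
    (hψ : ∀ x, ψ x = x - (1 - F x) / f x)
    (hprob : IsProbabilityMeasure (valueMeasure f))
    (hexp : Integrable (fun x => x) (valueMeasure f)) :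
    Integrable ψ (valueMeasure f) ∧
    ∀ t, 0 ≤ t → ∫ y, (if t < y then ψ y - t else 0) ∂(valueMeasure f) = 0 := by
  have tail := bk_tail hf_cont hf_pos hF hprob
  have hae := bk_ae_nonneg f
  set μ := valueMeasure f with hμ
  have hTm : Antitone (fun s => μ.real (Ioi s)) := fun a b hab =>
    measureReal_mono (Ioi_subset_Ioi hab)
  have hTi : IntegrableOn (fun s => μ.real (Ioi s)) (Ioi 0) := by
    refine ⟨hTm.measurable.aestronglyMeasurable, ?_⟩
    have key := lintegral_eq_lintegral_meas_lt μ hae hexp.aemeasurable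
    have hfin : ∫⁻ x, ENNReal.ofReal x ∂μ < ⊤ := hexp.lintegral_lt_top
    rw [key] at hfin
    refine lt_of_le_of_lt (lintegral_mono fun s => ?_) hfin
    rw [Real.enorm_eq_ofReal measureReal_nonneg, ofReal_measureReal]
    rfl
  set h : ℝ → ℝ := fun y => (1 - F y) / f y with hh
  have hhi : Integrable h μ := by
    rw [hμ, bk_integrable_iff hf_cont _ hf_pos, integrableOn_Ici_iff_integrableOn_Ioi]
    refine hTi.congr_fun (fun s hs => ?_) measurableSet_Ioi
    have := hf_pos s (le_of_lt hs)
    simp only [hh, tail s (le_of_lt hs)]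
    field_simp
  have hψe : ψ = fun y => y - h y := funext hψ
  refine ⟨by rw [hψe]; exact hexp.sub hhi, fun t ht => ?_⟩
  have hmi : Integrable (fun y => max (y - t) 0) μ :=
    (hexp.sub (integrable_const t)).sup (integrable_const 0)
  have e1 : ∫ y, (Ioi t).indicator h y ∂μ = ∫ y, max (y - t) 0 ∂μ := by
    rw [hmi.integral_eq_integral_meas_lt (ae_of_all _ fun y => le_max_right _ _),
      hμ, bk_integral hf_cont _ hf_pos]
    rw [← integral_indicator measurableSet_Ici, ← integral_indicator measurableSet_Ioi,
      ← integral_add_right_eq_self _ t]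
    congr 1; ext s
    by_cases hs : 0 < s
    · have h1 : 0 ≤ s + t := by linarith
      have hfp := hf_pos _ h1
      have : {a : ℝ | s < max (a - t) 0} = Ioi (s + t) := by
        ext a
        simp only [mem_ofPred_eq, lt_max_iff, mem_Ioi]
        constructor
        · rintro (h | h) <;> linarith
        · intro h; left; linarith
      rw [indicator_of_mem (show s + t ∈ Ici 0 from h1), indicator_of_mem (show s + t ∈ Ioi t by simpa),
        indicator_of_mem (show s ∈ Ioi 0 from hs), this]
      rw [← hμ, tail _ h1]
      simp only [hh]; field_simp
    · have h2 : s + t ∉ Ioi t := by simpa using hs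
      rw [indicator_of_notMem (show s ∉ Ioi 0 from hs)]
      by_cases h3 : s + t ∈ Ici 0
      · rw [indicator_of_mem h3, indicator_of_notMem h2, mul_zero]
      · rw [indicator_of_notMem h3]
  have e2 : (fun y => if t < y then ψ y - t else 0) =
      fun y => max (y - t) 0 - (Ioi t).indicator h y := by
    ext y
    by_cases hy : t < y
    · rw [if_pos hy, indicator_of_mem (show y ∈ Ioi t from hy), max_eq_left (by linarith), hψe]
      ring
    · rw [if_neg hy, indicator_of_notMem (show y ∉ Ioi t from hy), max_eq_right (by linarith)]
      ring
  rw [e2, integral_sub hmi (hhi.indicator measurableSet_Ioi), e1, sub_self]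

theorem bk_sup_integrable {α ι : Type*} [MeasurableSpace α] {μ : Measure α} (s : Finset ι)
    (hs : s.Nonempty) (g : ι → α → ℝ) (hg : ∀ i, Integrable (g i) μ) :
    Integrable (fun x => s.sup' hs (fun i => g i x)) μ := by
  have := Finset.sup'_induction hs g (p := fun u => Integrable u μ)
    (fun _ h1 _ h2 => h1.sup h2) (fun i _ => hg i)
  refine this.congr (ae_of_all _ fun x => ?_)
  simp [Finset.sup'_apply]

/-- The highest of the competing values of bidder `i`. -/
noncomputable def bkMax {n : ℕ} (hn : (Finset.univ : Finset (Fin n)).Nonempty)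
    (x : Fin n → ℝ) : ℝ :=
  Finset.univ.sup' hn x

theorem bk_vickrey {n : ℕ} (hn : (Finset.univ : Finset (Fin n)).Nonempty) (h2 : 2 ≤ n + 1)
    (ψ : ℝ → ℝ) (hreg : StrictMonoOn ψ (Ici 0))
    (hψm : Measurable ψ)
    (μ : Measure ℝ) [IsProbabilityMeasure μ]
    (hae : ∀ᵐ x ∂μ, 0 ≤ x) (hnull : ∀ c, μ {c} = 0)
    (hexp : Integrable (fun x => x) μ) (hψi : Integrable ψ μ)
    (hK : ∀ t, 0 ≤ t → ∫ y, (if t < y then ψ y - t else 0) ∂μ = 0) :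
    ∫ x : Fin (n + 1) → ℝ, Finset.univ.sup' Finset.univ_nonempty (fun i => ψ (x i))
        ∂(Measure.pi fun _ => μ)
      ≤ ∫ x : Fin (n + 1) → ℝ, secondHighest h2 x ∂(Measure.pi fun _ => μ) := by
  have hmax : Measurable (bkMax hn) := by
    unfold bkMax
    have := Finset.measurable_sup' hn (f := fun (i : Fin n) (x : Fin n → ℝ) => x i)
      (fun i _ => measurable_pi_apply i)
    convert this using 1
    ext x; simp [Finset.sup'_apply]
  let M : Fin (n + 1) → (Fin (n + 1) → ℝ) → ℝ := fun i x => bkMax hn (fun j => x (i.succAbove j))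
  have hMm : ∀ i, Measurable (M i) := fun i => hmax.comp (by fun_prop)
  have hei : ∀ i, Integrable (fun x : Fin (n + 1) → ℝ => x i) (Measure.pi fun _ => μ) :=
    fun i => integrable_comp_eval (μ := fun _ => μ) (i := i) hexp
  have hpi : ∀ i, Integrable (fun x : Fin (n + 1) → ℝ => ψ (x i)) (Measure.pi fun _ => μ) :=
    fun i => integrable_comp_eval (μ := fun _ => μ) (i := i) hψi
  have hMi : ∀ i, Integrable (M i) (Measure.pi fun _ => μ) := fun i =>
    bk_sup_integrable _ hn (fun j (x : Fin (n + 1) → ℝ) => x (i.succAbove j)) (fun j => hei _)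
  let H : Fin (n + 1) → (Fin (n + 1) → ℝ) → ℝ := fun i x =>
    if M i x < x i then ψ (x i) - M i x else 0
  have hHi : ∀ i, Integrable (H i) (Measure.pi fun _ => μ) := fun i => by
    have hs : MeasurableSet {x : Fin (n + 1) → ℝ | M i x < x i} :=
      measurableSet_lt (hMm i) (measurable_pi_apply i)
    refine (((hpi i).sub (hMi i)).indicator hs).congr (ae_of_all _ fun x => ?_)
    by_cases hx : M i x < x i
    · simp [H, hx]
    · simp [H, hx]
  have hSi : Integrable (fun x : Fin (n + 1) → ℝ => secondHighest h2 x)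
      (Measure.pi fun _ => μ) := by
    have hne' : ∀ i : Fin (n + 1), (Finset.univ.erase i).Nonempty := fun i => by
      rw [← Finset.card_pos, Finset.card_erase_of_mem (Finset.mem_univ i),
        Finset.card_univ, Fintype.card_fin]
      omega
    have hE : ∀ i : Fin (n + 1), Integrable (fun x : Fin (n + 1) → ℝ =>
        (Finset.univ.erase i).sup' (hne' i) x) (Measure.pi fun _ => μ) := fun i =>
      bk_sup_integrable (Finset.univ.erase i) (hne' i) (fun j (x : Fin (n + 1) → ℝ) => x j) hei
    exact bk_sup_integrable Finset.univ Finset.univ_nonempty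
      (fun i (x : Fin (n + 1) → ℝ) => min (x i) ((Finset.univ.erase i).sup' (hne' i) x))
      (fun i => (hei i).inf (hE i))
  have hnn : ∀ᵐ x ∂(Measure.pi fun _ : Fin (n + 1) => μ), ∀ i, 0 ≤ x i :=
    ae_all_iff.2 fun i => (Measure.quasiMeasurePreserving_eval (fun _ => μ) i).ae hae
  have hnn' : ∀ᵐ x ∂(Measure.pi fun _ : Fin n => μ), ∀ i, 0 ≤ x i :=
    ae_all_iff.2 fun i => (Measure.quasiMeasurePreserving_eval (fun _ => μ) i).ae hae
  have hH0 : ∀ i, ∫ x, H i x ∂(Measure.pi fun _ => μ) = 0 := fun i => by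
    have mp := (measurePreserving_piFinSuccAbove (fun _ : Fin (n + 1) => μ) i).symm
    have hint := (mp.integrable_comp_emb (MeasurableEquiv.measurableEmbedding _)).2 (hHi i)
    rw [← mp.integral_comp']
    refine (integral_prod_symm _ hint).trans ?_
    refine integral_eq_zero_of_ae ?_
    filter_upwards [hnn'] with x' hx'
    have hM0 : 0 ≤ bkMax hn x' := by
      obtain ⟨j, hj⟩ := hn
      exact (hx' j).trans (Finset.le_sup' x' hj)
    refine Eq.trans ?_ (hK _ hM0)
    refine integral_congr_ae (ae_of_all _ fun y => ?_)
    simp [H, M, MeasurableEquiv.piFinSuccAbove, Fin.insertNthEquiv]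
  have hne : ∀ᵐ x ∂(Measure.pi fun _ : Fin (n + 1) => μ), ∀ i, x i ≠ M i x := by
    refine ae_all_iff.2 fun i => ?_
    have mp := (measurePreserving_piFinSuccAbove (fun _ : Fin (n + 1) => μ) i)
    have hs : MeasurableSet {p : ℝ × (Fin n → ℝ) | p.1 = bkMax hn p.2} :=
      measurableSet_eq_fun measurable_fst (hmax.comp measurable_snd)
    have h0 : (μ.prod (Measure.pi fun _ : Fin n => μ))
        {p : ℝ × (Fin n → ℝ) | p.1 = bkMax hn p.2} = 0 := by
      rw [Measure.prod_apply_symm hs]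
      refine (lintegral_congr fun x' => ?_).trans lintegral_zero
      exact hnull (bkMax hn x')
    have := mp.quasiMeasurePreserving.preimage_null h0
    rw [ae_iff]
    refine measure_mono_null (fun x hx => ?_) this
    exact not_not.1 hx
  have hpt : ∀ᵐ x ∂(Measure.pi fun _ : Fin (n + 1) => μ),
      Finset.univ.sup' Finset.univ_nonempty (fun i => ψ (x i))
        ≤ secondHighest h2 x + ∑ i, H i x := by
    filter_upwards [hnn, hne] with x hx hxne
    obtain ⟨i, -, hi⟩ := Finset.exists_max_image Finset.univ x Finset.univ_nonempty
    have hi' : ∀ j, x j ≤ x i := fun j => hi j (Finset.mem_univ j)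
    have hMle : M i x ≤ x i := Finset.sup'_le _ _ fun j _ => hi' _
    have hMlt : M i x < x i := lt_of_le_of_ne hMle (hxne i).symm
    have hsum : ∑ k, H k x = ψ (x i) - M i x := by
      rw [Finset.sum_eq_single i]
      · simp [H, hMlt]
      · intro k _ hk
        have : x i ≤ M k x := by
          obtain ⟨j, rfl⟩ := Fin.exists_succAbove_eq hk.symm
          exact Finset.le_sup' (fun j => x (k.succAbove j)) (Finset.mem_univ j)
        have h3 : ¬ M k x < x k := not_lt.2 ((hi' k).trans this)
        simp [H, h3]
      · simp
    have hsec : M i x ≤ secondHighest h2 x := by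
      unfold secondHighest
      refine le_trans ?_ (Finset.le_sup' _ (Finset.mem_univ i))
      refine le_min hMle ?_
      refine Finset.sup'_le _ _ fun j _ => ?_
      exact Finset.le_sup' x (by simp [Fin.succAbove_ne])
    rw [hsum]
    refine Finset.sup'_le _ _ fun j _ => ?_
    have := hreg.monotoneOn (hx j) (hx i) (hi' j)
    linarith
  have hsi : Integrable (fun x => ∑ i, H i x) (Measure.pi fun _ : Fin (n + 1) => μ) :=
    integrable_finsetSum _ fun i _ => hHi i
  calc _ ≤ ∫ x, (secondHighest h2 x + ∑ i, H i x) ∂(Measure.pi fun _ : Fin (n + 1) => μ) :=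
        integral_mono_ae (bk_sup_integrable _ _ (fun i (x : Fin (n + 1) → ℝ) => ψ (x i)) hpi) (hSi.add hsi) hpt
    _ = _ := by
        rw [integral_add hSi hsi, integral_finsetSum _ fun i _ => hHi i]
        simp [hH0]

theorem bk_jensen {n : ℕ} (hn : (Finset.univ : Finset (Fin n)).Nonempty)
    (ψ : ℝ → ℝ) (μ : Measure ℝ) [IsProbabilityMeasure μ]
    (hψi : Integrable ψ μ) (h0 : ∫ y, ψ y ∂μ = 0) :
    ∫ x : Fin n → ℝ, max 0 (Finset.univ.sup' hn (fun i => ψ (x i))) ∂(Measure.pi fun _ => μ)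
    ≤ ∫ x : Fin (n + 1) → ℝ, Finset.univ.sup' Finset.univ_nonempty (fun i => ψ (x i))
        ∂(Measure.pi fun _ => μ) := by
  have hpi : ∀ m (i : Fin m), Integrable (fun x : Fin m → ℝ => ψ (x i)) (Measure.pi fun _ => μ) :=
    fun m i => integrable_comp_eval (μ := fun _ => μ) (i := i) hψi
  have mp := (measurePreserving_piFinSuccAbove (fun _ : Fin (n + 1) => μ) 0).symm
  have hint := (mp.integrable_comp_emb (MeasurableEquiv.measurableEmbedding _)).2
    (bk_sup_integrable Finset.univ Finset.univ_nonempty (fun i (x : Fin (n + 1) → ℝ) => ψ (x i))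
      (hpi _))
  rw [← mp.integral_comp']
  refine le_trans ?_ (integral_prod_symm _ hint).ge
  refine integral_mono ((integrable_const 0).sup (bk_sup_integrable _ hn _ (hpi n)))
    hint.integral_prod_right ?_
  intro x'
  set A := Finset.univ.sup' hn (fun i => ψ (x' i)) with hA
  have hmaxi : Integrable (fun y => max (ψ y) A) μ := hψi.sup (integrable_const A)
  have e : ∀ y, Finset.univ.sup' Finset.univ_nonempty (fun i => ψ
      ((MeasurableEquiv.piFinSuccAbove (fun _ : Fin (n + 1) => ℝ) 0).symm (y, x') i))
      = max (ψ y) A := by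
    intro y
    apply le_antisymm
    · refine Finset.sup'_le _ _ fun i _ => ?_
      refine Fin.cases ?_ (fun j => ?_) i
      · simp [MeasurableEquiv.piFinSuccAbove, Fin.insertNthEquiv]
      · refine le_trans ?_ (le_max_right _ _)
        refine le_trans ?_ (Finset.le_sup' (fun i => ψ (x' i)) (Finset.mem_univ j))
        simp [MeasurableEquiv.piFinSuccAbove, Fin.insertNthEquiv]
    · refine max_le ?_ (Finset.sup'_le _ _ fun j _ => ?_)
      · refine le_trans (le_of_eq ?_) (Finset.le_sup' _ (Finset.mem_univ 0))
        simp [MeasurableEquiv.piFinSuccAbove, Fin.insertNthEquiv]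
      · refine le_trans (le_of_eq ?_) (Finset.le_sup' _ (Finset.mem_univ j.succ))
        simp [MeasurableEquiv.piFinSuccAbove, Fin.insertNthEquiv]
  have goal : max 0 A ≤ ∫ y, max (ψ y) A ∂μ := by
    refine max_le ?_ ?_
    · rw [← h0]; exact integral_mono hψi hmaxi fun y => le_max_left _ _
    · calc A = ∫ _, A ∂μ := by simp
        _ ≤ _ := integral_mono (integrable_const A) hmaxi fun y => le_max_right _ _
  refine goal.trans (le_of_eq ?_)
  exact integral_congr_ae (ae_of_all _ fun y => (e y).symm)

/-- **Bulow–Klemperer.**  For i.i.d. regular values, the expected revenue of the Vickrey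
auction (second-price, no reserve) with `n+1` bidders — the expected second-highest of
`n+1` values — is at least the expected revenue `E[max(0, maxᵢ ψ(Xᵢ))]` of the Myerson
auction with `n` bidders. -/
theorem bulow_klemperer
    (n : ℕ) (hn : 1 ≤ n)
    (F f ψ : ℝ → ℝ)
    (hf_cont : Continuous f) (hf_pos : ∀ x, 0 ≤ x → 0 < f x)
    (hF : ∀ x, F x = ∫ t in (0:ℝ)..x, f t)
    (hψ : ∀ x, ψ x = x - (1 - F x) / f x)
    (hreg : StrictMonoOn ψ (Ici 0))
    (μ : Measure ℝ) (hμ : μ = valueMeasure f)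
    (hprob : IsProbabilityMeasure μ)
    (hexp : Integrable (fun x => x) μ) :
    (∫ x : Fin n → ℝ,
        max 0 (Finset.univ.sup' ⟨⟨0, by omega⟩, Finset.mem_univ _⟩ fun i => ψ (x i))
        ∂(Measure.pi fun _ => μ))
      ≤ ∫ x : Fin (n + 1) → ℝ, secondHighest (by omega) x ∂(Measure.pi fun _ => μ) := by
  subst hμ
  have hFc : Continuous F := by
    rw [show F = fun x => ∫ t in (0:ℝ)..x, f t from funext hF]
    exact intervalIntegral.continuous_primitive (fun a b => hf_cont.intervalIntegrable a b) 0
  have hψm : Measurable ψ := by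
    rw [show ψ = fun x => x - (1 - F x) / f x from funext hψ]
    have := hFc.measurable
    have := hf_cont.measurable
    fun_prop
  obtain ⟨hψi, hK⟩ := bk_one_dim hf_cont hf_pos hF hψ hprob hexp
  have h0 : ∫ y, ψ y ∂(valueMeasure f) = 0 := by
    rw [← hK 0 le_rfl]
    refine integral_congr_ae ?_
    have hne : ∀ᵐ y ∂(valueMeasure f), y ≠ 0 := by
      rw [ae_iff]; simpa using bk_null f 0
    filter_upwards [bk_ae_nonneg f, hne] with y hy hy0
    simp [lt_of_le_of_ne hy hy0.symm]
  exact (bk_jensen ⟨⟨0, by omega⟩, Finset.mem_univ _⟩ ψ _ hψi h0).trans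
    (bk_vickrey ⟨⟨0, by omega⟩, Finset.mem_univ _⟩ (by omega) ψ hreg hψm _ (bk_ae_nonneg f)
      (bk_null f) hexp hψi hK)
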